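/- arXiv:2310.04969 — 3 statements merged into one kernel-verified Lean document; each statement's English description precedes it below -/
import Mathlib

section
/- For every n ≥ 1, the Eulerian polynomial satisfies A_n(x) = ∑_{k=0}^{⌊(n−1)/2⌋} γ_{n,k} x^k (1+x)^{n−1−2k} as an identity of polynomials in ℤ[x], where γ_{n,k} is the number of permutations σ ∈ S_n with des(σ) = k and dd(σ) = 0 (no double descents). -/
/-- The letter at (1-based) position `i` of the word `w`, with the boundary
convention that positions `0` and `> w.length` carry the value `w.length + 1`
(playing the role of `+∞` for a permutation word of `{1,…,n}`). -/
def wB (w : List ℕ) (i : ℕ) : ℕ :=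
  if 1 ≤ i ∧ i ≤ w.length then w.getD (i - 1) 0 else w.length + 1

/-- The one-line word `σ_1 ⋯ σ_n` (with letters in `{1,…,n}`) of a permutation of `Fin n`. -/
def word {n : ℕ} (σ : Equiv.Perm (Fin n)) : List ℕ := List.ofFn (fun i => (σ i : ℕ) + 1)

/-- Number of descents: indices `i ∈ {1,…,n-1}` with `σ_i > σ_{i+1}`. -/
def desW (w : List ℕ) : ℕ :=
  ((Finset.Icc 1 (w.length - 1)).filter (fun i => wB w (i + 1) < wB w i)).card

/-- Number of ascents: indices `i ∈ {1,…,n-1}` with `σ_i < σ_{i+1}`. -/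
def ascW (w : List ℕ) : ℕ :=
  ((Finset.Icc 1 (w.length - 1)).filter (fun i => wB w i < wB w (i + 1))).card

/-- Position `i` is a double ascent: `σ_{i-1} < σ_i < σ_{i+1}` (boundary `σ_0 = σ_{n+1} = +∞`). -/
abbrev isDAat (w : List ℕ) (i : ℕ) : Prop := wB w (i - 1) < wB w i ∧ wB w i < wB w (i + 1)

/-- Position `i` is a double descent: `σ_{i-1} > σ_i > σ_{i+1}`. -/
abbrev isDDat (w : List ℕ) (i : ℕ) : Prop := wB w i < wB w (i - 1) ∧ wB w (i + 1) < wB w i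

/-- Position `i` is a peak: `σ_{i-1} < σ_i > σ_{i+1}`. -/
abbrev isPkat (w : List ℕ) (i : ℕ) : Prop := wB w (i - 1) < wB w i ∧ wB w (i + 1) < wB w i

/-- Position `i` is a valley: `σ_{i-1} > σ_i < σ_{i+1}`. -/
abbrev isVlat (w : List ℕ) (i : ℕ) : Prop := wB w i < wB w (i - 1) ∧ wB w i < wB w (i + 1)

/-- Position `i` holds a left-to-right minimum: `σ_j > σ_i` for all `j < i`. -/
abbrev isLRat (w : List ℕ) (i : ℕ) : Prop := ∀ j ∈ Finset.Icc 1 (i - 1), wB w i < wB w j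

/-- Position `i` holds a right-to-left minimum: `σ_j > σ_i` for all `j > i`. -/
abbrev isRLat (w : List ℕ) (i : ℕ) : Prop := ∀ j ∈ Finset.Icc (i + 1) w.length, wB w i < wB w j

/-- `da`, the number of double ascents. -/
def daW (w : List ℕ) : ℕ := ((Finset.Icc 1 w.length).filter (isDAat w)).card

/-- `dd`, the number of double descents. -/
def ddW (w : List ℕ) : ℕ := ((Finset.Icc 1 w.length).filter (isDDat w)).card

/-- `M`, the number of peaks. -/
def pkW (w : List ℕ) : ℕ := ((Finset.Icc 1 w.length).filter (isPkat w)).card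

/-- `LRmin`, the number of left-to-right minima. -/
def lrminW (w : List ℕ) : ℕ := ((Finset.Icc 1 w.length).filter (isLRat w)).card

/-- `RLmin`, the number of right-to-left minima. -/
def rlminW (w : List ℕ) : ℕ := ((Finset.Icc 1 w.length).filter (isRLat w)).card

/-- The word belongs to `PRW`: if it has an ascent, the first ascent occurs at the letter `1`. -/
abbrev isPRW (w : List ℕ) : Prop :=
  ∀ i ∈ Finset.Icc 1 (w.length - 1), wB w i < wB w (i + 1) →
    (∀ j ∈ Finset.Icc 1 (i - 1), ¬ wB w j < wB w (j + 1)) → wB w i = 1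

/-- The set `PRW_n` of permutations whose first ascent (if any) appears at the letter `1`. -/
def PRW (n : ℕ) : Finset (Equiv.Perm (Fin n)) :=
  Finset.univ.filter (fun σ => isPRW (word σ))

/-- The polynomial ring in the variables `0, 1, 2`, which mark peaks, double descents and
double ascents. -/
abbrev StatRing : Type := MvPolynomial (Fin 3) ℤ

namespace StatRing

/-- The variable marking peaks. -/
noncomputable def pk : StatRing := MvPolynomial.X 0

/-- The variable marking double descents. -/
noncomputable def dd : StatRing := MvPolynomial.X 1

/-- The variable marking double ascents. -/
noncomputable def da : StatRing := MvPolynomial.X 2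

/-- The derivation describing the insertion of a new largest letter into a word. -/
noncomputable def insertion : Derivation ℤ StatRing StatRing :=
  MvPolynomial.mkDerivation ℤ ![(dd + da) * pk, pk, pk]

@[simp] lemma insertion_pk : insertion pk = (dd + da) * pk := by
  simp [insertion, pk, MvPolynomial.mkDerivation_X]

@[simp] lemma insertion_dd : insertion dd = pk := by
  simp [insertion, dd, MvPolynomial.mkDerivation_X]

@[simp] lemma insertion_da : insertion da = pk := by
  simp [insertion, da, MvPolynomial.mkDerivation_X]

/-- The polynomials in `pk` and `dd + da`. -/
noncomputable def symmetricPart : Subalgebra ℤ StatRing := Algebra.adjoin ℤ {pk, dd + da}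

lemma pk_mem : pk ∈ symmetricPart := Algebra.subset_adjoin (by simp)

lemma dd_add_da_mem : dd + da ∈ symmetricPart := Algebra.subset_adjoin (by simp)

lemma insertion_mem {f : StatRing} (hf : f ∈ symmetricPart) : insertion f ∈ symmetricPart := by
  induction hf using Algebra.adjoin_induction with
  | mem x hx =>
    rcases hx with rfl | rfl
    · simpa using mul_mem dd_add_da_mem pk_mem
    · simpa using add_mem pk_mem pk_mem
  | algebraMap r => simp
  | add x y _ _ hx hy => simpa using add_mem hx hy
  | mul x y hx' hy' hx hy =>
    rw [Derivation.leibniz, smul_eq_mul, smul_eq_mul]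
    exact add_mem (mul_mem hx' hy) (mul_mem hy' hx)

/-- The specialization recovering `x ^ des`. -/
noncomputable def evalDes : StatRing →ₐ[ℤ] Polynomial ℤ :=
  MvPolynomial.aeval ![Polynomial.X, Polynomial.X, 1]

/-- The specialization that discards words with a double descent. -/
noncomputable def evalNoDD : StatRing →ₐ[ℤ] Polynomial ℤ :=
  MvPolynomial.aeval ![Polynomial.X, 0, 1 + Polynomial.X]

@[simp] lemma evalDes_pk : evalDes pk = Polynomial.X := by simp [evalDes, pk]
@[simp] lemma evalDes_dd : evalDes dd = Polynomial.X := by simp [evalDes, dd]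
@[simp] lemma evalDes_da : evalDes da = 1 := by simp [evalDes, da]
@[simp] lemma evalNoDD_pk : evalNoDD pk = Polynomial.X := by simp [evalNoDD, pk]
@[simp] lemma evalNoDD_dd : evalNoDD dd = 0 := by simp [evalNoDD, dd]
@[simp] lemma evalNoDD_da : evalNoDD da = 1 + Polynomial.X := by simp [evalNoDD, da]

lemma evalDes_eq_evalNoDD {f : StatRing} (hf : f ∈ symmetricPart) :
    evalDes f = evalNoDD f := by
  have h : symmetricPart ≤ AlgHom.equalizer evalDes evalNoDD := by
    refine Algebra.adjoin_le ?_
    rintro x (rfl | rfl)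
    · simp
    · simp [add_comm]
  exact h hf

/-- The variable marking the type of the letter `b` between the letters `a` and `c`. -/
noncomputable def letter (a b c : ℕ) : StatRing :=
  if a < b then (if b < c then da else pk) else (if b < c then 1 else dd)

/-- The product of the variables of all interior letters of a list. -/
noncomputable def weight : List ℕ → StatRing
  | a :: b :: c :: l => letter a b c * weight (b :: c :: l)
  | _ => 1

lemma weight_cons (a b c : ℕ) (l : List ℕ) :
    weight (a :: b :: c :: l) = letter a b c * weight (b :: c :: l) := by
  simp [weight]

lemma weight_congr_of_lt {a b c : ℕ} (l : List ℕ) (ha : c < a) (hb : c < b) :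
    weight (a :: c :: l) = weight (b :: c :: l) := by
  cases l with
  | nil => simp [weight]
  | cons e l => simp [weight, letter, ha.not_gt, hb.not_gt]

lemma sum_weight_insert_after {m N : ℕ} (hN : m < N) (l : List ℕ) (a b : ℕ)
    (hnd : (a :: b :: l).Nodup) (hm : ∀ x ∈ b :: l, x < m) :
    ((l.permutations'Aux m).map fun w => weight (a :: b :: (w ++ [N]))).sum +
        (if a < b then weight (a :: m :: b :: (l ++ [N])) else 0) =
      insertion (weight (a :: b :: (l ++ [N]))) + da * weight (a :: b :: (l ++ [N])) := by
  induction l generalizing a b with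
  | nil =>
    have hb : b < m := hm b (by simp)
    have hbN := hb.trans hN
    by_cases hab : a < b
    · have ham := hab.trans hb
      simp [weight, letter, hb, hN, hab, hb.not_gt, ham, hbN]
      ring
    · simp [weight, letter, hb, hN, hab, hbN]
  | cons c l ih =>
    have hb : b < m := hm b (by simp)
    have hc : c < m := hm c (by simp)
    have ih := ih b c hnd.of_cons (fun x hx => hm x (List.mem_cons_of_mem _ hx))
    have hbc : b ≠ c := by
      rintro rfl
      simp at hnd
    have hZ : weight (b :: m :: c :: (l ++ [N])) = pk * weight (m :: c :: (l ++ [N])) := by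
      rw [weight_cons]
      simp [letter, hb, hc.not_gt]
    have hins : ((l.permutations'Aux m).map
          fun w => weight (a :: b :: c :: (w ++ [N]))).sum = letter a b c *
        ((l.permutations'Aux m).map fun w => weight (b :: c :: (w ++ [N]))).sum := by
      simp only [weight_cons, List.sum_map_mul_left]
    simp only [List.permutations'Aux, List.map_cons, List.map_map, Function.comp_def,
      List.cons_append, List.sum_cons]
    rw [hins, eq_sub_of_add_eq ih]
    rw [weight_cons a b m, weight_cons a b c, weight_cons a m b, weight_cons m b c]
    rw [Derivation.leibniz, smul_eq_mul, smul_eq_mul, hZ]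
    rcases lt_or_gt_of_ne hbc with h | h
    · by_cases hab : a < b
      · have ham := hab.trans hb
        simp [letter, h, hb, hab, hb.not_gt, ham]
        ring
      · simp [letter, h, hb, hab]
    · rw [weight_congr_of_lt _ hc h]
      by_cases hab : a < b
      · have ham := hab.trans hb
        simp [letter, h.not_gt, hb, hab, hb.not_gt, ham]
        ring
      · simp [letter, h.not_gt, hb, hab]
        ring

lemma sum_weight_insert {m N : ℕ} (hN : m < N) {w : List ℕ} (hw : w ≠ []) (hnd : w.Nodup)
    (hm : ∀ x ∈ w, x < m) :
    ((w.permutations'Aux m).map fun v => weight (N :: (v ++ [N]))).sum =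
      (dd + da) * weight (N :: (w ++ [N])) + insertion (weight (N :: (w ++ [N]))) := by
  obtain ⟨b, l, rfl⟩ := List.exists_cons_of_ne_nil hw
  have hb : b < m := hm b (by simp)
  have hnd' : (N :: b :: l).Nodup :=
    List.nodup_cons.2 ⟨fun h => (hN.trans (hm N h)).false, hnd⟩
  have h := sum_weight_insert_after hN l N b hnd' hm
  rw [if_neg (hb.trans hN).not_gt, add_zero] at h
  simp only [List.permutations'Aux, List.map_cons, List.map_map, Function.comp_def,
    List.cons_append, List.sum_cons]
  rw [h, weight_cons, weight_congr_of_lt _ hb (hb.trans hN)]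
  simp only [letter, hN.not_gt, hb.not_gt, if_false]
  ring

lemma sum_weight_permutations'_mem {N : ℕ} (L : List ℕ) (hL : L.Pairwise (· > ·))
    (hN : ∀ x ∈ L, x < N) :
    (L.permutations'.map fun w => weight (N :: (w ++ [N]))).sum ∈ symmetricPart := by
  induction L with
  | nil => simp [weight]
  | cons m L ih =>
    have hmN : m < N := hN m (by simp)
    rcases eq_or_ne L [] with rfl | hne
    · simp [weight, letter, hmN, hmN.not_gt]
    rw [List.pairwise_cons] at hL
    have ih := ih hL.2 (fun x hx => hN x (List.mem_cons_of_mem _ hx))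
    have key : ((m :: L).permutations'.map fun w => weight (N :: (w ++ [N]))).sum =
        (dd + da) * (L.permutations'.map fun w => weight (N :: (w ++ [N]))).sum +
          insertion (L.permutations'.map fun w => weight (N :: (w ++ [N]))).sum := by
      rw [map_list_sum, List.map_map, ← List.sum_map_mul_left, ← List.sum_map_add,
        List.permutations', List.map_flatMap, List.flatMap_def, List.sum_flatten, List.map_map]
      congr 1
      refine List.map_congr_left fun w hw => ?_
      have hp : w.Perm L := List.mem_permutations'.1 hw
      exact sum_weight_insert hmN (fun h => hne (by simpa [h] using hp))
        (hp.nodup_iff.2 (hL.2.imp fun h => h.ne')) (fun x hx => hL.1 x (hp.mem_iff.1 hx))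
    rw [key]
    exact add_mem (mul_mem dd_add_da_mem ih) (insertion_mem ih)

lemma weight_eq_prod (l : List ℕ) (d : ℕ) :
    weight l = ∏ i ∈ Finset.range (l.length - 2),
      letter (l.getD i d) (l.getD (i + 1) d) (l.getD (i + 2) d) := by
  induction l using weight.induct with
  | case1 a b c l ih =>
    rw [weight_cons, ih]
    simp only [List.length_cons, show l.length + 1 + 1 + 1 - 2 = l.length + 1
      by omega, show l.length + 1 + 1 - 2 = l.length by omega]
    rw [Finset.prod_range_succ', mul_comm]
    simp
  | case2 l h =>
    rcases l with _ | ⟨a, _ | ⟨b, _ | ⟨c, l⟩⟩⟩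
    · simp [weight]
    · simp [weight]
    · simp [weight]
    · exact absurd rfl (h a b c l)

end StatRing

open StatRing

lemma wB_eq_getD (w : List ℕ) (i : ℕ) :
    wB w i = ((w.length + 1) :: (w ++ [w.length + 1])).getD i (w.length + 1) := by
  unfold wB
  rcases i with _ | i
  · simp
  · rcases lt_trichotomy i w.length with h | h | h
    · rw [if_pos ⟨by omega, h⟩]
      simp [List.getElem?_append_left h, h]
    · subst h
      simp
    · rw [if_neg (by omega)]
      have h' : w.length + 1 ≤ i := h
      simp [List.getElem?_eq_none, h']

lemma weight_eq_prod_wB (w : List ℕ) :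
    weight ((w.length + 1) :: (w ++ [w.length + 1])) =
      ∏ i ∈ Finset.range w.length, letter (wB w i) (wB w (i + 1)) (wB w (i + 2)) := by
  rw [weight_eq_prod _ (w.length + 1)]
  simp only [wB_eq_getD]
  simp

lemma length_word {n : ℕ} (σ : Equiv.Perm (Fin n)) : (word σ).length = n := by
  simp [word]

lemma wB_word {n : ℕ} (σ : Equiv.Perm (Fin n)) (i : Fin n) :
    wB (word σ) (i + 1) = σ i + 1 := by
  have := i.2
  simp [wB, word, i.2]

lemma wB_word_zero {n : ℕ} (σ : Equiv.Perm (Fin n)) : wB (word σ) 0 = n + 1 := by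
  simp [wB, length_word]

lemma wB_word_last {n : ℕ} (σ : Equiv.Perm (Fin n)) : wB (word σ) (n + 1) = n + 1 := by
  simp [wB, length_word]

lemma wB_word_lt {n : ℕ} (σ : Equiv.Perm (Fin n)) {i : ℕ} (hi : i < n) :
    wB (word σ) (i + 1) < n + 1 := by
  rw [wB_word σ ⟨i, hi⟩]
  omega

lemma wB_word_ne {n : ℕ} (hn : 1 ≤ n) (σ : Equiv.Perm (Fin n)) {i : ℕ} (hi : i ≤ n) :
    wB (word σ) i ≠ wB (word σ) (i + 1) := by
  rcases i with _ | i
  · rw [wB_word_zero]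
    exact (wB_word_lt σ hn).ne'
  · rcases hi.lt_or_eq with h | h
    · rw [wB_word σ ⟨i, by omega⟩, wB_word σ ⟨i + 1, h⟩]
      intro he
      have := σ.injective (Fin.ext (Nat.succ_injective he))
      simp at this
    · subst h
      rw [wB_word_last]
      exact (wB_word_lt σ (Nat.lt_succ_self i)).ne

lemma card_filter_Icc_one (n : ℕ) (P : ℕ → Prop) [DecidablePred P] :
    ((Finset.Icc 1 n).filter P).card = ∑ i ∈ Finset.range n, if P (i + 1) then 1 else 0 := by
  rw [Finset.card_filter, Finset.range_eq_Ico, Finset.sum_Ico_add' (fun i => if P i then 1 else 0)]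
  rfl

lemma desW_word {n : ℕ} (hn : 1 ≤ n) (σ : Equiv.Perm (Fin n)) :
    desW (word σ) =
      ∑ i ∈ Finset.range n, if wB (word σ) (i + 2) < wB (word σ) (i + 1) then 1 else 0 := by
  obtain ⟨n, rfl⟩ := Nat.exists_eq_add_of_le' hn
  rw [desW, length_word, card_filter_Icc_one, Finset.sum_range_succ, wB_word_last, if_neg]
  · simp
  · exact (wB_word_lt σ (Nat.lt_succ_self n)).not_gt

lemma desW_word_add_one {n : ℕ} (hn : 1 ≤ n) (σ : Equiv.Perm (Fin n)) :
    desW (word σ) + 1 =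
      ∑ i ∈ Finset.range n, if wB (word σ) (i + 1) < wB (word σ) i then 1 else 0 := by
  obtain ⟨n, rfl⟩ := Nat.exists_eq_add_of_le' hn
  rw [desW, length_word, card_filter_Icc_one, Finset.sum_range_succ', wB_word_zero, if_pos]
  · simp
  · exact wB_word_lt σ hn

lemma pkW_add_ddW {n : ℕ} (hn : 1 ≤ n) (σ : Equiv.Perm (Fin n)) :
    pkW (word σ) + ddW (word σ) = desW (word σ) := by
  rw [desW_word hn, pkW, ddW, length_word, card_filter_Icc_one, card_filter_Icc_one,
    ← Finset.sum_add_distrib]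
  refine Finset.sum_congr rfl fun i hi => ?_
  have hi := Finset.mem_range.1 hi
  have h1 := wB_word_ne hn σ (i := i) (by omega)
  simp only [isPkat, isDDat, Nat.add_sub_cancel, add_assoc, Nat.reduceAdd]
  split_ifs <;> omega

lemma two_mul_desW_add_daW {n : ℕ} (hn : 1 ≤ n) (σ : Equiv.Perm (Fin n)) :
    2 * desW (word σ) + 1 + daW (word σ) = n + ddW (word σ) := by
  have h : desW (word σ) + (desW (word σ) + 1) + daW (word σ) =
      (∑ i ∈ Finset.range n, 1) + ddW (word σ) := by
    rw [desW_word_add_one hn, desW_word hn, daW, ddW, length_word, card_filter_Icc_one,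
      card_filter_Icc_one, ← Finset.sum_add_distrib, ← Finset.sum_add_distrib,
      ← Finset.sum_add_distrib]
    refine Finset.sum_congr rfl fun i hi => ?_
    have hi := Finset.mem_range.1 hi
    have h1 := wB_word_ne hn σ (i := i) (by omega)
    have h2 := wB_word_ne hn σ (i := i + 1) (by omega)
    simp only [isDAat, isDDat, Nat.add_sub_cancel, add_assoc, Nat.reduceAdd] at h2 ⊢
    split_ifs <;> omega
  simp at h
  omega

lemma weight_word_eq_monomial {n : ℕ} (hn : 1 ≤ n) (σ : Equiv.Perm (Fin n)) :
    weight ((n + 1) :: (word σ ++ [n + 1])) =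
      pk ^ pkW (word σ) * dd ^ ddW (word σ) * da ^ daW (word σ) := by
  have h := weight_eq_prod_wB (word σ)
  rw [length_word] at h
  rw [h, pkW, ddW, daW, length_word, card_filter_Icc_one, card_filter_Icc_one,
    card_filter_Icc_one, ← Finset.prod_pow_eq_pow_sum, ← Finset.prod_pow_eq_pow_sum,
    ← Finset.prod_pow_eq_pow_sum, ← Finset.prod_mul_distrib, ← Finset.prod_mul_distrib]
  refine Finset.prod_congr rfl fun i hi => ?_
  have hi := Finset.mem_range.1 hi
  have h1 := wB_word_ne hn σ (i := i) (by omega)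
  have h2 := wB_word_ne hn σ (i := i + 1) (by omega)
  simp only [isPkat, isDAat, isDDat, Nat.add_sub_cancel, letter]
  rcases lt_or_gt_of_ne h1 with h1 | h1 <;> rcases lt_or_gt_of_ne h2 with h2 | h2 <;>
    simp [h1, h2, h1.not_gt, h2.not_gt]

lemma word_injective (n : ℕ) : Function.Injective (word : Equiv.Perm (Fin n) → List ℕ) := by
  intro σ τ h
  ext i
  have := congrFun (List.ofFn_injective h) i
  simpa using this

lemma word_perm {n : ℕ} (σ τ : Equiv.Perm (Fin n)) : (word σ).Perm (word τ) := by
  have h (ρ : Equiv.Perm (Fin n)) : (word ρ).Perm (List.ofFn fun i : Fin n => (i : ℕ) + 1) :=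
    ρ.ofFn_comp_perm fun i : Fin n => (i : ℕ) + 1
  exact (h σ).trans (h τ).symm

lemma nodup_word {n : ℕ} (σ : Equiv.Perm (Fin n)) : (word σ).Nodup :=
  List.nodup_ofFn.2 fun _ _ h => σ.injective (Fin.ext (Nat.succ_injective h))

lemma sum_word {M : Type*} [AddCommMonoid M] {n : ℕ} (τ : Equiv.Perm (Fin n)) (f : List ℕ → M) :
    ∑ σ : Equiv.Perm (Fin n), f (word σ) = ((word τ).permutations'.map f).sum := by
  have hnd : (word τ).permutations'.Nodup :=
    (List.permutations_perm_permutations' _).nodup_iff.1 (List.nodup_permutations _ (nodup_word τ))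
  rw [← List.sum_toFinset f hnd, ← Finset.sum_image (f := f) (word_injective n).injOn]
  congr 1
  refine Finset.eq_of_subset_of_card_le ?_ ?_
  · intro w hw
    obtain ⟨σ, -, rfl⟩ := Finset.mem_image.1 hw
    simpa using word_perm σ τ
  · rw [Finset.card_image_of_injective _ (word_injective n), List.toFinset_card_of_nodup hnd,
      (List.permutations_perm_permutations' _).symm.length_eq, List.length_permutations,
      length_word, Finset.card_univ, Fintype.card_perm, Fintype.card_fin]

lemma sum_weight_word_mem (n : ℕ) :
    ∑ σ : Equiv.Perm (Fin n), weight ((n + 1) :: (word σ ++ [n + 1])) ∈ symmetricPart := by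
  rw [sum_word Fin.revPerm fun w => weight ((n + 1) :: (w ++ [n + 1]))]
  refine sum_weight_permutations'_mem _ ?_ ?_
  · rw [word, List.pairwise_ofFn]
    intro i j hij
    exact Nat.succ_lt_succ (Fin.rev_lt_rev.2 hij)
  · intro x hx
    obtain ⟨i, rfl⟩ := List.mem_ofFn.1 hx
    exact Nat.succ_lt_succ (Fin.is_lt _)

/-- Foata–Schützenberger: the `γ`-positivity expansion of the Eulerian
polynomial `A_n(x) = ∑_{σ ∈ S_n} x^{des σ}`, where `γ_{n,k}` counts permutations of `[n]`
with `k` descents and no double descents. -/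
theorem eulerian_gamma_positivity (n : ℕ) (hn : 1 ≤ n) :
    (∑ σ : Equiv.Perm (Fin n), (Polynomial.X : Polynomial ℤ) ^ desW (word σ)) =
      ∑ k ∈ Finset.range ((n - 1) / 2 + 1),
        (((Finset.univ : Finset (Equiv.Perm (Fin n))).filter
            (fun σ => desW (word σ) = k ∧ ddW (word σ) = 0)).card : Polynomial ℤ) *
          Polynomial.X ^ k * (1 + Polynomial.X) ^ (n - 1 - 2 * k) := by
  have h := evalDes_eq_evalNoDD (sum_weight_word_mem n)
  simp only [map_sum, weight_word_eq_monomial hn, map_mul, map_pow, evalDes_pk, evalDes_dd,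
    evalDes_da, evalNoDD_pk, evalNoDD_dd, evalNoDD_da, one_pow, mul_one, ← pow_add,
    pkW_add_ddW hn] at h
  rw [h]
  have hle (σ : Equiv.Perm (Fin n)) (hσ : ddW (word σ) = 0) :
      desW (word σ) ∈ Finset.range ((n - 1) / 2 + 1) := by
    have := two_mul_desW_add_daW hn σ
    rw [Finset.mem_range]
    omega
  calc ∑ σ : Equiv.Perm (Fin n), (Polynomial.X : Polynomial ℤ) ^ pkW (word σ) *
        0 ^ ddW (word σ) * (1 + Polynomial.X) ^ daW (word σ)
      = ∑ σ : Equiv.Perm (Fin n) with ddW (word σ) = 0, (Polynomial.X : Polynomial ℤ) ^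
          desW (word σ) * (1 + Polynomial.X) ^ (n - 1 - 2 * desW (word σ)) := by
        rw [Finset.sum_filter]
        refine Finset.sum_congr rfl fun σ _ => ?_
        split_ifs with h0
        · have h1 := pkW_add_ddW hn σ
          have h2 := two_mul_desW_add_daW hn σ
          rw [show n - 1 - 2 * desW (word σ) = daW (word σ) by omega,
            show desW (word σ) = pkW (word σ) by omega, h0, pow_zero, mul_one]
        · simp [h0]
    _ = _ := by
        rw [← Finset.sum_fiberwise_of_maps_to (g := fun σ => desW (word σ))
          (fun σ hσ => hle σ (Finset.mem_filter.1 hσ).2)]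
        refine Finset.sum_congr rfl fun k _ => ?_
        rw [Finset.filter_filter, mul_assoc, ← nsmul_eq_mul]
        simp only [and_comm (a := ddW _ = 0)]
        refine Finset.sum_eq_card_nsmul fun σ hσ => ?_
        rw [(Finset.mem_filter.1 hσ).2.1]
end

section
/- For every n ≥ 1, the binomial-Eulerian polynomial satisfies Ã_n(x) = ∑_{π ∈ PRW_{n+1}} x^{asc(π)} as an identity of polynomials in ℤ[x]. -/
lemma wB_succ (w : List ℕ) (i : ℕ) (hi : i < w.length) : wB w (i + 1) = w.getD i 0 := by
  simp [wB, hi]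

lemma wB_cons_succ (a : ℕ) (w : List ℕ) (i : ℕ) (h1 : 1 ≤ i) (hi : i ≤ w.length) :
    wB (a :: w) (i + 1) = wB w i := by
  obtain ⟨j, rfl⟩ := Nat.exists_eq_add_of_le' h1
  rw [wB_succ _ _ (by simp; omega), wB_succ _ _ (by omega)]
  simp

lemma wB_cons_one (a : ℕ) (w : List ℕ) : wB (a :: w) 1 = a := by
  simp [wB]

lemma wB_cons_cons_two (a b : ℕ) (w : List ℕ) : wB (a :: b :: w) 2 = b := by
  simp [wB]

lemma wB_ofFn {m : ℕ} (g : Fin m → ℕ) (i : ℕ) (hi : i < m) :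
    wB (List.ofFn g) (i + 1) = g ⟨i, hi⟩ := by
  rw [wB_succ _ _ (by simpa using hi), List.getD_eq_getElem _ _ (by simpa using hi)]
  simp

lemma ascW_nil : ascW [] = 0 := by simp [ascW]

lemma ascW_singleton (a : ℕ) : ascW [a] = 0 := by simp [ascW]

lemma ascW_cons_cons (a b : ℕ) (l : List ℕ) :
    ascW (a :: b :: l) = (if a < b then 1 else 0) + ascW (b :: l) := by
  have hsplit : Finset.Icc 1 ((a :: b :: l).length - 1) =
      insert 1 ((Finset.Icc 1 ((b :: l).length - 1)).map (addRightEmbedding 1)) := by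
    ext i
    simp only [List.length_cons, Finset.mem_Icc, Finset.mem_insert, Finset.mem_map,
      addRightEmbedding_apply]
    constructor
    · intro h
      by_cases h1 : i = 1
      · exact Or.inl h1
      · exact Or.inr ⟨i - 1, by omega, by omega⟩
    · rintro (rfl | ⟨j, hj, rfl⟩) <;> omega
  simp only [ascW, Finset.card_filter]
  rw [hsplit, Finset.sum_insert (by simp), Finset.sum_map]
  congr 1
  refine Finset.sum_congr rfl fun i hi => ?_
  simp only [List.length_cons, Finset.mem_Icc] at hi
  rw [addRightEmbedding_apply, wB_cons_succ _ _ _ hi.1 (by simp; omega),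
    wB_cons_succ _ _ _ (by omega) (by simp; omega)]

lemma desW_ofFn_eq_ascW_ofFn {m : ℕ} (g h : Fin m → ℕ) (hgh : ∀ i j, g j < g i ↔ h i < h j) :
    desW (List.ofFn g) = ascW (List.ofFn h) := by
  unfold desW ascW
  simp only [List.length_ofFn]
  congr 1
  refine Finset.filter_congr fun i hi => ?_
  rw [Finset.mem_Icc] at hi
  obtain ⟨j, rfl⟩ := Nat.exists_eq_add_of_le' hi.1
  rw [wB_ofFn _ _ (by omega), wB_ofFn _ _ (by omega), wB_ofFn _ _ (by omega),
    wB_ofFn _ _ (by omega)]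
  exact hgh _ _

lemma isPRW_singleton (a : ℕ) : isPRW [a] := by
  intro i hi
  simp only [List.length_singleton, Finset.mem_Icc] at hi
  omega

lemma isPRW_cons_cons_of_lt {a b : ℕ} (l : List ℕ) (hab : a < b) :
    isPRW (a :: b :: l) ↔ a = 1 := by
  constructor
  · intro h
    have := h 1 (by simp) (by rwa [wB_cons_one, wB_cons_cons_two]) (by simp)
    rwa [wB_cons_one] at this
  · rintro rfl i hi - hfirst
    rw [Finset.mem_Icc] at hi
    rcases hi.1.eq_or_lt with rfl | hlt
    · exact wB_cons_one _ _
    · refine absurd ?_ (hfirst 1 (by rw [Finset.mem_Icc]; omega))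
      rwa [wB_cons_one, wB_cons_cons_two]

lemma isPRW_cons_cons_of_not_lt {a b : ℕ} (l : List ℕ) (hab : ¬ a < b) :
    isPRW (a :: b :: l) ↔ isPRW (b :: l) := by
  constructor
  · intro h i hi hasc hfirst
    simp only [List.length_cons, Finset.mem_Icc] at hi
    rw [← wB_cons_succ a _ i hi.1 (by simp; omega)]
    refine h (i + 1) (by simp; omega) ?_ fun j hj => ?_
    · rwa [wB_cons_succ _ _ _ hi.1 (by simp; omega),
        wB_cons_succ _ _ _ (by omega) (by simp; omega)]
    · rw [Finset.mem_Icc] at hj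
      rcases hj.1.eq_or_lt with rfl | hlt
      · rwa [wB_cons_one, wB_cons_cons_two]
      · obtain ⟨k, rfl⟩ := Nat.exists_eq_add_of_le' hj.1
        rw [wB_cons_succ _ _ _ (by omega) (by simp; omega),
          wB_cons_succ _ _ _ (by omega) (by simp; omega)]
        exact hfirst k (by rw [Finset.mem_Icc]; omega)
  · intro h i hi hasc hfirst
    simp only [List.length_cons, Finset.mem_Icc] at hi
    rcases hi.1.eq_or_lt with rfl | hlt
    · rw [wB_cons_one, wB_cons_cons_two] at hasc
      exact absurd hasc hab
    · obtain ⟨k, rfl⟩ := Nat.exists_eq_add_of_le' hi.1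
      rw [wB_cons_succ _ _ _ (by omega) (by simp; omega)] at hasc ⊢
      rw [wB_cons_succ _ _ _ (by omega) (by simp; omega)] at hasc
      refine h k (by simp; omega) hasc fun j hj => ?_
      rw [Finset.mem_Icc] at hj
      have := hfirst (j + 1) (by rw [Finset.mem_Icc]; omega)
      rwa [wB_cons_succ _ _ _ (by omega) (by simp; omega),
        wB_cons_succ _ _ _ (by omega) (by simp; omega)] at this

lemma ascW_one_cons {l : List ℕ} (hl : ∀ x ∈ l, 1 < x) :
    ascW (1 :: l) = if l = [] then 0 else ascW l + 1 := by
  cases l with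
  | nil => simp [ascW_singleton]
  | cons b l => simp [ascW_cons_cons, hl b (by simp), add_comm]

lemma isPRW_append_one_cons {d l : List ℕ} (hd : ∀ x ∈ d, 1 < x) (hl : ∀ x ∈ l, 1 < x) :
    isPRW (d ++ 1 :: l) ↔ d.Pairwise (· ≥ ·) := by
  rw [← List.isChain_iff_pairwise]
  induction d with
  | nil =>
    cases l with
    | nil => exact iff_of_true (isPRW_singleton 1) List.IsChain.nil
    | cons b l => simp [isPRW_cons_cons_of_lt l (hl b (by simp))]
  | cons a d ih =>
    have ha : 1 < a := hd a (by simp)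
    specialize ih fun x hx => hd x (by simp [hx])
    cases d with
    | nil =>
      simp only [List.cons_append, List.nil_append] at ih ⊢
      rw [isPRW_cons_cons_of_not_lt _ (by omega), ih]
      simp
    | cons b d =>
      simp only [List.cons_append] at ih ⊢
      rw [List.isChain_cons_cons, ← ih]
      by_cases hab : a < b
      · rw [isPRW_cons_cons_of_lt _ hab]
        constructor <;> intro <;> omega
      · rw [isPRW_cons_cons_of_not_lt _ hab]
        exact (and_iff_right (not_lt.mp hab)).symm

lemma ascW_append_one_cons {d : List ℕ} (l : List ℕ) (hd : ∀ x ∈ d, 1 < x)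
    (hdec : d.Pairwise (· ≥ ·)) : ascW (d ++ 1 :: l) = ascW (1 :: l) := by
  induction d with
  | nil => rfl
  | cons a d ih =>
    have ha : 1 < a := hd a (by simp)
    rw [List.pairwise_cons] at hdec
    specialize ih (fun x hx => hd x (by simp [hx])) hdec.2
    cases d with
    | nil =>
      rw [List.cons_append, List.nil_append, ascW_cons_cons, if_neg (by omega), zero_add]
    | cons b d =>
      have hab : b ≤ a := hdec.1 b (by simp)
      simp only [List.cons_append] at ih ⊢
      rw [ascW_cons_cons, if_neg (by omega), zero_add, ih]

/-- The words in which each letter of `S` occurs exactly once. -/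
noncomputable def orderings (S : Finset ℕ) : Finset (List ℕ) := S.toList.permutations.toFinset

lemma mem_orderings {S : Finset ℕ} {l : List ℕ} :
    l ∈ orderings S ↔ l.Nodup ∧ l.toFinset = S := by
  simp only [orderings, List.mem_toFinset, List.mem_permutations]
  constructor
  · intro h
    exact ⟨h.nodup_iff.mpr S.nodup_toList, by rw [List.toFinset_eq_of_perm _ _ h]; simp⟩
  · rintro ⟨hnd, rfl⟩
    exact (List.toFinset_toList hnd).symm

lemma sum_perm_ofFn {R : Type*} [AddCommMonoid R] {m : ℕ} (f : Fin m ↪ ℕ) (S : Finset ℕ)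
    (hS : Finset.univ.map f = S) (F : List ℕ → R) :
    ∑ σ : Equiv.Perm (Fin m), F (List.ofFn fun i => f (σ i)) = ∑ l ∈ orderings S, F l := by
  subst hS
  refine Finset.sum_bij (fun σ _ => List.ofFn fun i => f (σ i)) ?_ ?_ ?_ fun _ _ => rfl
  · intro σ _
    rw [mem_orderings, List.nodup_ofFn]
    refine ⟨f.injective.comp σ.injective, ?_⟩
    ext x
    simp only [List.mem_toFinset, List.mem_ofFn, Finset.mem_map, Finset.mem_univ, true_and]
    exact σ.surjective.exists (p := fun i => f i = x) |>.symm
  · intro σ _ τ _ h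
    ext i
    exact congrArg Fin.val (f.injective (congrFun (List.ofFn_injective h) i))
  · intro l hl
    rw [mem_orderings] at hl
    obtain ⟨hnd, hl⟩ := hl
    have hlen : l.length = m := by
      rw [← List.toFinset_card_of_nodup hnd, hl]; simp
    subst hlen
    have hmem : ∀ i : Fin l.length, ∃ j, f j = l.get i := fun i => by
      have : l.get i ∈ l.toFinset := by simp
      rw [hl] at this
      simpa using this
    choose g hg using hmem
    have hinj : Function.Injective g := fun i j hij =>
      List.nodup_iff_injective_get.mp hnd (by rw [← hg i, ← hg j, hij])
    refine ⟨Equiv.ofBijective g hinj.bijective_of_finite, Finset.mem_univ _, ?_⟩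
    simp only [Equiv.ofBijective_apply, hg, List.ofFn_get]

lemma sum_perm_word {R : Type*} [AddCommMonoid R] (n : ℕ) (F : List ℕ → R) :
    ∑ σ : Equiv.Perm (Fin n), F (word σ) = ∑ l ∈ orderings (Finset.Icc 1 n), F l := by
  refine sum_perm_ofFn (Fin.valEmbedding.trans (addRightEmbedding 1)) _ ?_ F
  rw [← Finset.map_map, Fin.map_valEmbedding_univ]
  ext i
  simp only [Finset.mem_map, Finset.mem_Iio, addRightEmbedding_apply, Finset.mem_Icc]
  constructor
  · rintro ⟨j, hj, rfl⟩; omega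
  · intro h; exact ⟨i - 1, by omega, by omega⟩

lemma sum_orderings_pow_ascW {R : Type*} [CommSemiring R] (x : R) (S : Finset ℕ) :
    ∑ l ∈ orderings S, x ^ ascW l = ∑ σ : Equiv.Perm (Fin S.card), x ^ desW (word σ) := by
  let e := S.orderEmbOfFin rfl
  rw [← sum_perm_ofFn (Fin.revPerm.toEmbedding.trans e.toEmbedding) S]
  · refine Finset.sum_congr rfl fun σ _ => ?_
    congr 1
    refine (desW_ofFn_eq_ascW_ofFn _ _ fun i j => ?_).symm
    simp [e]
  · rw [← Finset.map_map, Finset.map_univ_equiv]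
    exact Finset.map_orderEmbOfFin_univ S rfl

lemma sum_orderings_one_cons {R : Type*} [CommSemiring R] (x : R) {S : Finset ℕ}
    (hS : ∀ a ∈ S, 1 < a) :
    ∑ l ∈ orderings S, x ^ ascW (1 :: l) =
      if S.card = 0 then 1
      else x * ∑ σ : Equiv.Perm (Fin S.card), x ^ desW (word σ) := by
  split_ifs with h
  · rw [Finset.card_eq_zero] at h
    subst h
    simp [orderings, ascW_singleton]
  · rw [← sum_orderings_pow_ascW, Finset.mul_sum]
    refine Finset.sum_congr rfl fun l hl => ?_
    obtain ⟨-, rfl⟩ := mem_orderings.mp hl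
    rw [ascW_one_cons (by simpa using hS), if_neg (by rintro rfl; simp at h), pow_succ']

lemma sum_isPRW_orderings {R : Type*} [CommSemiring R] (x : R) (n : ℕ) :
    ∑ l ∈ (orderings (Finset.Icc 1 (n + 1))).filter isPRW, x ^ ascW l =
      ∑ S ∈ (Finset.Icc 2 (n + 1)).powerset, ∑ l ∈ orderings S, x ^ ascW (1 :: l) := by
  rw [Finset.sum_sigma']
  symm
  refine Finset.sum_bij
    (fun p _ => (Finset.Icc 2 (n + 1) \ p.1).sort (· ≥ ·) ++ 1 :: p.2) ?_ ?_ ?_ ?_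
  · rintro ⟨S, l⟩ h
    simp only [Finset.mem_sigma, Finset.mem_powerset, mem_orderings] at h
    obtain ⟨hS, hnd, rfl⟩ := h
    have hl : ∀ a ∈ l, 1 < a := fun a ha =>
      (Finset.mem_Icc.mp (hS (List.mem_toFinset.mpr ha))).1
    rw [Finset.mem_filter, isPRW_append_one_cons _ hl, mem_orderings]
    · refine ⟨⟨?_, ?_⟩, Finset.pairwise_sort _ _⟩
      · rw [List.nodup_append, List.nodup_cons]
        refine ⟨Finset.sort_nodup _ _, ⟨fun h1 => (hl 1 h1).ne rfl, hnd⟩, ?_⟩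
        rintro a ha b hb rfl
        simp only [Finset.mem_sort, Finset.mem_sdiff, Finset.mem_Icc, List.mem_toFinset,
          List.mem_cons] at ha hb
        rcases hb with rfl | hb
        · omega
        · exact ha.2 hb
      · ext a
        have := @hS a
        simp only [List.mem_toFinset, Finset.mem_Icc] at this
        simp only [List.mem_toFinset, List.mem_append, List.mem_cons, Finset.mem_sort,
          Finset.mem_sdiff, Finset.mem_Icc]
        by_cases ha : a ∈ l <;> simp [ha] at this ⊢ <;> omega
    · intro a ha
      simp only [Finset.mem_sort, Finset.mem_sdiff, Finset.mem_Icc] at ha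
      omega
  · rintro ⟨S, l⟩ h ⟨S', l'⟩ h' heq
    simp only [Finset.mem_sigma, Finset.mem_powerset, mem_orderings] at h h'
    obtain ⟨hS, hnd, rfl⟩ := h
    obtain ⟨-, -, rfl⟩ := h'
    have h1 : 1 ∉ l := fun h => by simpa using hS (List.mem_toFinset.mpr h)
    have h1d : 1 ∉ (Finset.Icc 2 (n + 1) \ l.toFinset).sort (· ≥ ·) := by simp
    obtain ⟨-, -, rfl⟩ := (List.append_cons_inj_of_notMem h1d h1).mp heq
    rfl
  · intro w hw
    rw [Finset.mem_filter, mem_orderings] at hw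
    obtain ⟨⟨hnd, hw⟩, hprw⟩ := hw
    have h1 : 1 ∈ w := by rw [← List.mem_toFinset, hw]; simp
    obtain ⟨d, l, rfl⟩ := List.append_of_mem h1
    have hmem : ∀ a, a ∈ d ∨ a = 1 ∨ a ∈ l ↔ 1 ≤ a ∧ a ≤ n + 1 := fun a => by
      rw [← Finset.mem_Icc, ← hw]; simp [or_left_comm]
    rw [List.nodup_append, List.nodup_cons] at hnd
    obtain ⟨hd, ⟨h1l, hl⟩, hdl⟩ := hnd
    have h1d : 1 ∉ d := fun h => hdl 1 h 1 (by simp) rfl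
    have hd1 : ∀ a ∈ d, 1 < a := fun a ha =>
      lt_of_le_of_ne ((hmem a).mp (Or.inl ha)).1 fun h => h1d (h ▸ ha)
    have hl1 : ∀ a ∈ l, 1 < a := fun a ha =>
      lt_of_le_of_ne ((hmem a).mp (Or.inr (Or.inr ha))).1 fun h => h1l (h ▸ ha)
    rw [isPRW_append_one_cons hd1 hl1] at hprw
    refine ⟨⟨l.toFinset, l⟩, ?_, ?_⟩
    · simp only [Finset.mem_sigma, Finset.mem_powerset, mem_orderings]
      refine ⟨fun a ha => ?_, hl, trivial⟩
      rw [List.mem_toFinset] at ha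
      exact Finset.mem_Icc.mpr ⟨hl1 a ha, ((hmem a).mp (Or.inr (Or.inr ha))).2⟩
    · have hcompl : Finset.Icc 2 (n + 1) \ l.toFinset = d.toFinset := by
        ext a
        simp only [Finset.mem_sdiff, Finset.mem_Icc, List.mem_toFinset]
        constructor
        · rintro ⟨ha, hal⟩
          rcases (hmem a).mpr ⟨by omega, ha.2⟩ with h | h | h
          · exact h
          · omega
          · exact absurd h hal
        · intro ha
          exact ⟨⟨hd1 a ha, ((hmem a).mp (Or.inl ha)).2⟩,
            fun hal => hdl a ha a (by simp [hal]) rfl⟩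
      have hsort : (Finset.Icc 2 (n + 1) \ l.toFinset).sort (· ≥ ·) = d := by
        refine List.Perm.eq_of_pairwise' (Finset.pairwise_sort _ _) hprw ?_
        rw [hcompl]
        exact (Finset.sort_perm_toList _ _).trans (List.toFinset_toList hd)
      simp only [hsort]
  · rintro ⟨S, l⟩ _
    refine congrArg (x ^ ·) (ascW_append_one_cons l (fun a ha => ?_)
      (Finset.pairwise_sort _ _)).symm
    simp only [Finset.mem_sort, Finset.mem_sdiff, Finset.mem_Icc] at ha
    omega

/-- Postnikov–Reiner–Williams: the binomial-Eulerian polynomial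
`Ã_n(x) = 1 + x ∑_{m=1}^n C(n,m) A_m(x)` equals `∑_{π ∈ PRW_{n+1}} x^{asc π}`. -/
theorem binomialEulerian_eq_sum_PRW (n : ℕ) (hn : 1 ≤ n) :
    (1 : Polynomial ℤ) + Polynomial.X *
        ∑ m ∈ Finset.Icc 1 n, (n.choose m : Polynomial ℤ) *
          ∑ σ : Equiv.Perm (Fin m), Polynomial.X ^ desW (word σ)
      = ∑ π ∈ PRW (n + 1), Polynomial.X ^ ascW (word π) := by
  have hPRW : ∑ π ∈ PRW (n + 1), (Polynomial.X : Polynomial ℤ) ^ ascW (word π) =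
      ∑ l ∈ (orderings (Finset.Icc 1 (n + 1))).filter isPRW, Polynomial.X ^ ascW l := by
    rw [PRW, Finset.sum_filter, Finset.sum_filter]
    exact sum_perm_word (n + 1) fun w =>
      if isPRW w then (Polynomial.X : Polynomial ℤ) ^ ascW w else 0
  have hone : ∀ S ∈ (Finset.Icc 2 (n + 1)).powerset, ∀ a ∈ S, 1 < a := fun S hS a ha =>
    (Finset.mem_Icc.mp (Finset.mem_powerset.mp hS ha)).1
  rw [hPRW, sum_isPRW_orderings,
    Finset.sum_congr rfl fun S hS => sum_orderings_one_cons Polynomial.X (hone S hS),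
    Finset.sum_powerset_apply_card fun m => if m = 0 then (1 : Polynomial ℤ) else
      Polynomial.X * ∑ σ : Equiv.Perm (Fin m), Polynomial.X ^ desW (word σ),
    Nat.card_Icc, show n + 1 + 1 - 2 = n by omega, Finset.sum_range_succ', add_comm,
    Finset.mul_sum]
  congr 1
  · rw [Finset.range_eq_Ico, Finset.sum_Ico_add' (fun m => n.choose m • if m = 0 then
      (1 : Polynomial ℤ) else Polynomial.X * ∑ σ : Equiv.Perm (Fin m), Polynomial.X ^ desW (word σ)),
      zero_add, Finset.Ico_add_one_right_eq_Icc]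
    refine Finset.sum_congr rfl fun m hm => ?_
    rw [if_neg (by rw [Finset.mem_Icc] at hm; omega), nsmul_eq_mul]
    ring
  · simp
end

section
/- For every n ≥ 1, the binomial-Eulerian polynomial satisfies Ã_n(x) = ∑_{k=0}^{⌊n/2⌋} c_{n,k} x^k (1+x)^{n−2k} as an identity of polynomials in ℤ[x], where c_{n,k} is the number of permutations σ ∈ S_n with des(σ) = k such that there is no index i with 1 < i < n and σ_{i−1} > σ_i > σ_{i+1}. -/
/-- `σ` has no index `1 < i < n` with `σ_{i-1} > σ_i > σ_{i+1}`. -/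
abbrev noInternalDD (w : List ℕ) : Prop :=
  ∀ i ∈ Finset.Icc 2 (w.length - 1),
    ¬ (wB w (i + 1) < wB w i ∧ wB w i < wB w (i - 1))

namespace BinomialEulerian

open Polynomial

variable {α : Type*} [LinearOrder α]

/-- The number of descents of a list. -/
def des : List α → ℕ
  | a :: b :: l => (if b < a then 1 else 0) + des (b :: l)
  | _ => 0

/-- The list has no three consecutive decreasing letters. -/
def NoDD : List α → Prop
  | a :: b :: c :: l => ¬ (c < b ∧ b < a) ∧ NoDD (b :: c :: l)
  | _ => True

/-- The list has no three consecutive decreasing letters and does not end in a descent. -/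
def NoDDEndAsc : List α → Prop
  | a :: b :: c :: l => ¬ (c < b ∧ b < a) ∧ NoDDEndAsc (b :: c :: l)
  | [a, b] => ¬ b < a
  | _ => True

theorem des_map {β : Type*} [LinearOrder β] {e : α → β} (he : StrictMono e) (l : List α) :
    des (l.map e) = des l := by
  induction l using des.induct with
  | case1 a b l ih =>
    simp only [List.map_cons, des, he.lt_iff_lt] at ih ⊢
    rw [ih]
  | case2 l h =>
    match l, h with
    | [], _ => rfl
    | [_], _ => rfl
    | a :: b :: l, h => exact absurd rfl (h a b l)

theorem des_append_cons {m : α} : ∀ {u v : List α}, (∀ a ∈ u, m < a) → (∀ a ∈ v, m < a) →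
    des (u ++ m :: v) = (if u = [] then 0 else 1) + des u + des v
  | [], [], _, _ => by simp [des]
  | [], b :: v, _, hv => by
    have := hv b (by simp)
    simp [des, this.not_gt]
  | [a], v, hu, hv => by
    have h := des_append_cons (u := []) (by simp) hv
    have := hu a (by simp)
    simp only [List.nil_append, List.cons_append] at h ⊢
    simp [des, this, h]
  | a :: b :: u, v, hu, hv => by
    have h := des_append_cons (u := b :: u) (fun x hx => hu x (by simp_all)) hv
    simp only [List.cons_append] at h ⊢
    simp only [des, h]
    simp
    omega

theorem noDD_append_cons {m : α} : ∀ {u v : List α}, (∀ a ∈ u, m < a) → (∀ a ∈ v, m < a) →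
    (NoDD (u ++ m :: v) ↔ NoDDEndAsc u ∧ NoDD v)
  | [], [], _, _ => by simp [NoDD, NoDDEndAsc]
  | [], [b], _, hv => by simp [NoDD, NoDDEndAsc]
  | [], b :: c :: v, _, hv => by
    have := hv b (by simp)
    simp [NoDD, NoDDEndAsc, this.not_gt]
  | [a], [], hu, hv => by simp [NoDD, NoDDEndAsc]
  | [a], b :: v, hu, hv => by
    have h := noDD_append_cons (u := []) (by simp) hv
    have := hv b (by simp)
    simp only [List.nil_append, List.cons_append] at h ⊢
    simp [NoDD, this.not_gt, h, NoDDEndAsc]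
  | [a, b], v, hu, hv => by
    have h := noDD_append_cons (u := [b]) (fun x hx => hu x (by simp_all)) hv
    have := hu b (by simp)
    simp only [List.nil_append, List.cons_append] at h ⊢
    simp [NoDD, this, h, NoDDEndAsc]
  | a :: b :: c :: u, v, hu, hv => by
    have h := noDD_append_cons (u := b :: c :: u) (fun x hx => hu x (by simp_all)) hv
    simp only [List.cons_append] at h ⊢
    simp only [NoDD, NoDDEndAsc, h]
    tauto

theorem noDDEndAsc_append_cons {m : α} : ∀ {u v : List α}, (∀ a ∈ u, m < a) → (∀ a ∈ v, m < a) →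
    (NoDDEndAsc (u ++ m :: v) ↔ NoDDEndAsc u ∧ NoDDEndAsc v ∧ (v = [] → u = []))
  | [], [], _, _ => by simp [NoDDEndAsc]
  | [], [b], _, hv => by
    have := hv b (by simp)
    simp [NoDDEndAsc, this.le]
  | [], b :: c :: v, _, hv => by
    have := hv b (by simp)
    simp [NoDDEndAsc, this.not_gt]
  | [a], [], hu, hv => by
    have := hu a (by simp)
    simp [NoDDEndAsc, this]
  | [a], b :: v, hu, hv => by
    have h := noDDEndAsc_append_cons (u := []) (by simp) hv
    have := hv b (by simp)
    simp only [List.nil_append, List.cons_append] at h ⊢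
    simp [this.not_gt, h, NoDDEndAsc]
  | [a, b], v, hu, hv => by
    have h := noDDEndAsc_append_cons (u := [b]) (fun x hx => hu x (by simp_all)) hv
    have := hu b (by simp)
    simp only [List.nil_append, List.cons_append] at h ⊢
    simp [this, h, NoDDEndAsc]
  | a :: b :: c :: u, v, hu, hv => by
    have h := noDDEndAsc_append_cons (u := b :: c :: u) (fun x hx => hu x (by simp_all)) hv
    simp only [List.cons_append] at h ⊢
    simp only [NoDDEndAsc, h]
    simp
    tauto

theorem NoDD.two_mul_des_le : ∀ {l : List α}, NoDD l → 2 * des l ≤ l.length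
  | [], _ => by simp [des]
  | [a], _ => by simp [des]
  | [a, b], _ => by simp only [des]; split_ifs <;> simp
  | a :: b :: c :: l, h => by
    have h1 := NoDD.two_mul_des_le h.2
    have h2 : NoDD (c :: l) := by
      cases l with
      | nil => trivial
      | cons d l => exact h.2.2
    have h3 := NoDD.two_mul_des_le h2
    have h4 := h.1
    simp only [des, List.length_cons] at *
    split_ifs at * <;> first | omega | tauto

theorem NoDDEndAsc.two_mul_des_lt : ∀ {l : List α}, NoDDEndAsc l → l ≠ [] →
    2 * des l + 1 ≤ l.length
  | [], _, h => by simp at h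
  | [a], _, _ => by simp [des]
  | [a, b], h, _ => by
    have h : ¬ b < a := h
    simp [des, h]
  | a :: b :: c :: l, h, _ => by
    have h1 := NoDDEndAsc.two_mul_des_lt h.2 (by simp)
    have h2 : NoDDEndAsc (c :: l) := by
      cases l with
      | nil => trivial
      | cons d l => exact h.2.2
    have h3 := NoDDEndAsc.two_mul_des_lt h2 (by simp)
    have h4 := h.1
    simp only [des, List.length_cons] at *
    split_ifs at * <;> first | omega | tauto

/-- The lists enumerating the elements of `s` without repetition. -/
noncomputable def arrangements (s : Finset α) : Finset (List α) := s.toList.permutations.toFinset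

theorem mem_arrangements {s : Finset α} {l : List α} :
    l ∈ arrangements s ↔ l.Nodup ∧ l.toFinset = s := by
  rw [arrangements, List.mem_toFinset, List.mem_permutations]
  constructor
  · intro h
    exact ⟨h.nodup_iff.2 s.nodup_toList, by rw [List.toFinset_eq_of_perm _ _ h]; simp⟩
  · rintro ⟨h, rfl⟩
    exact (List.perm_of_nodup_nodup_toFinset_eq h (Finset.nodup_toList _) (by simp))

theorem card_arrangements (s : Finset α) : (arrangements s).card = s.card.factorial := by
  rw [arrangements, List.toFinset_card_of_nodup (List.nodup_permutations _ s.nodup_toList),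
    List.length_permutations, Finset.length_toList]

theorem arrangements_empty : arrangements (∅ : Finset α) = {[]} := by
  ext l
  simp [mem_arrangements]
  rintro rfl
  simp

theorem length_of_mem_arrangements {s : Finset α} {l : List α} (h : l ∈ arrangements s) :
    l.length = s.card := by
  obtain ⟨h1, rfl⟩ := mem_arrangements.1 h
  exact (List.toFinset_card_of_nodup h1).symm

theorem eq_nil_iff_of_mem_arrangements {s : Finset α} {l : List α} (h : l ∈ arrangements s) :
    l = [] ↔ s = ∅ := by
  rw [← List.length_eq_zero_iff, length_of_mem_arrangements h, Finset.card_eq_zero]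

theorem mem_of_mem_arrangements {s : Finset α} {l : List α} (h : l ∈ arrangements s) {a : α}
    (ha : a ∈ l) : a ∈ s := by
  rw [← (mem_arrangements.1 h).2]
  simpa

/-- Splitting an arrangement of `insert m s` at the letter `m`. -/
theorem sum_arrangements_insert {M : Type*} [AddCommMonoid M] {s : Finset α} {m : α} (hm : m ∉ s)
    (f : List α → M) :
    ∑ l ∈ arrangements (insert m s), f l =
      ∑ t ∈ s.powerset, ∑ u ∈ arrangements t, ∑ v ∈ arrangements (s \ t), f (u ++ m :: v) := by
  simp_rw [← Finset.sum_product', Finset.sum_sigma']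
  symm
  refine Finset.sum_bij (fun p _ => p.2.1 ++ m :: p.2.2) ?_ ?_ ?_ (fun _ _ => rfl)
  · rintro ⟨t, u, v⟩ h
    simp only [Finset.mem_sigma, Finset.mem_powerset, Finset.mem_product, mem_arrangements] at h ⊢
    obtain ⟨ht, ⟨hu, rfl⟩, hv, hvs⟩ := h
    have hmu : m ∉ u := fun h => hm (ht (by simpa))
    have hmv : m ∉ v := fun h => hm (by
      have : m ∈ v.toFinset := by simpa
      rw [hvs] at this
      exact (Finset.mem_sdiff.1 this).1)
    have hd : ∀ a ∈ u, a ∉ v := fun a ha hav => by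
      have : a ∈ v.toFinset := by simpa
      rw [hvs] at this
      exact (Finset.mem_sdiff.1 this).2 (by simpa)
    constructor
    · rw [List.nodup_append]
      refine ⟨hu, List.nodup_cons.2 ⟨hmv, hv⟩, ?_⟩
      rintro a ha b hb rfl
      rcases List.mem_cons.1 hb with rfl | hb
      · exact hmu ha
      · exact hd a ha hb
    · rw [List.toFinset_append, List.toFinset_cons, hvs, Finset.union_insert,
        Finset.union_sdiff_of_subset ht]
  · rintro ⟨t, u, v⟩ h ⟨t', u', v'⟩ h' heq
    simp only [Finset.mem_sigma, Finset.mem_powerset, Finset.mem_product] at h h'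
    have hmu : m ∉ u := fun hh => hm (h.1 (mem_of_mem_arrangements h.2.1 hh))
    have hmu' : m ∉ u' := fun hh => hm (h'.1 (mem_of_mem_arrangements h'.2.1 hh))
    have hmv : m ∉ v := fun hh =>
      hm (Finset.mem_sdiff.1 (mem_of_mem_arrangements h.2.2 hh)).1
    dsimp only at heq
    obtain ⟨rfl, -, rfl⟩ := (List.append_cons_inj_of_notMem hmu hmv).1 heq
    obtain rfl := (mem_arrangements.1 h.2.1).2
    obtain rfl := (mem_arrangements.1 h'.2.1).2
    rfl
  · intro l hl
    obtain ⟨hl, hls⟩ := mem_arrangements.1 hl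
    have hml : m ∈ l := by rw [← List.mem_toFinset, hls]; simp
    obtain ⟨u, v, rfl⟩ := List.append_of_mem hml
    rw [List.nodup_append, List.nodup_cons] at hl
    obtain ⟨hu, ⟨hmv, hv⟩, hd⟩ := hl
    have hs : s = u.toFinset ∪ v.toFinset := by
      have hmu : m ∉ u := fun h => hd m h m (by simp) rfl
      rw [← Finset.erase_insert hm, ← hls]
      ext a
      by_cases ha : a = m
      · subst ha; simp [hmu, hmv]
      · simp [ha]
    refine ⟨⟨u.toFinset, u, v⟩, ?_, rfl⟩
    simp only [Finset.mem_sigma, Finset.mem_powerset, Finset.mem_product, mem_arrangements]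
    refine ⟨by simp [hs], ⟨hu, trivial⟩, hv, ?_⟩
    rw [hs, Finset.union_sdiff_cancel_left]
    rw [Finset.disjoint_left]
    intro a ha hb
    exact hd a (by simpa using ha) a (by simp_all) rfl

theorem sum_perm_eq_sum_arrangements {M : Type*} [AddCommMonoid M] {m : ℕ} {e : Fin m → α}
    (he : Function.Injective e) (f : List α → M) :
    ∑ σ : Equiv.Perm (Fin m), f (List.ofFn (fun i => e (σ i))) =
      ∑ l ∈ arrangements (Finset.univ.image e), f l := by
  have hinj : Function.Injective
      (fun σ : Equiv.Perm (Fin m) => List.ofFn (fun i => e (σ i))) := by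
    intro σ τ h
    have h := List.ofFn_injective h
    ext i
    rw [he (congrFun h i)]
  have himg : arrangements (Finset.univ.image e) =
      Finset.univ.image (fun σ : Equiv.Perm (Fin m) => List.ofFn (fun i => e (σ i))) := by
    symm
    apply Finset.eq_of_subset_of_card_le
    · intro l hl
      simp only [Finset.mem_image, Finset.mem_univ, true_and] at hl
      obtain ⟨σ, rfl⟩ := hl
      rw [mem_arrangements]
      refine ⟨List.nodup_ofFn.2 (he.comp σ.injective), ?_⟩
      ext a
      simp only [List.mem_toFinset, List.mem_ofFn, Finset.mem_image, Finset.mem_univ, true_and]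
      exact ⟨fun ⟨i, hi⟩ => ⟨σ i, hi⟩, fun ⟨i, hi⟩ => ⟨σ.symm i, by simpa using hi⟩⟩
    · rw [card_arrangements, Finset.card_image_of_injective _ he,
        Finset.card_image_of_injective _ hinj]
      simp [Fintype.card_perm]
  rw [himg, Finset.sum_image (fun _ _ _ _ h => hinj h)]

/-- The Eulerian polynomial of a finite set of letters. -/
noncomputable def eulerian (s : Finset α) : ℤ[X] := ∑ l ∈ arrangements s, X ^ des l

/-- `X` times the Eulerian polynomial of a nonempty set of letters, and `1` for the empty set. -/
noncomputable def shiftedEulerian (s : Finset α) : ℤ[X] := if s = ∅ then 1 else X * eulerian s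

open Classical in
/-- The gamma expansion over arrangements with no double descent and no final descent. -/
noncomputable def gammaEndAsc (s : Finset α) : ℤ[X] :=
  ∑ l ∈ arrangements s, if NoDDEndAsc l then X ^ des l * (1 + X) ^ (s.card - 1 - 2 * des l) else 0

open Classical in
/-- The gamma expansion over arrangements with no double descent. -/
noncomputable def gammaSum (s : Finset α) : ℤ[X] :=
  ∑ l ∈ arrangements s, if NoDD l then X ^ des l * (1 + X) ^ (s.card - 2 * des l) else 0

theorem eulerian_empty : eulerian (∅ : Finset α) = 1 := by
  simp [eulerian, arrangements_empty, des]

theorem gammaSum_empty : gammaSum (∅ : Finset α) = 1 := by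
  simp [gammaSum, arrangements_empty, des, NoDD]

theorem eulerian_insert {s : Finset α} {m : α} (hm : ∀ a ∈ s, m < a) :
    eulerian (insert m s) = ∑ t ∈ s.powerset, shiftedEulerian t * eulerian (s \ t) := by
  rw [eulerian, sum_arrangements_insert (fun h => (hm m h).false)]
  refine Finset.sum_congr rfl fun t ht => ?_
  rw [Finset.mem_powerset] at ht
  have key : shiftedEulerian t = ∑ u ∈ arrangements t, X ^ ((if u = [] then 0 else 1) + des u) := by
    rw [shiftedEulerian]
    split_ifs with h
    · subst h
      simp [arrangements_empty, des]
    · rw [eulerian, Finset.mul_sum]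
      refine Finset.sum_congr rfl fun u hu => ?_
      rw [if_neg (by rwa [eq_nil_iff_of_mem_arrangements hu]), pow_add, pow_one]
  rw [key, eulerian, Finset.sum_mul_sum]
  refine Finset.sum_congr rfl fun u hu => Finset.sum_congr rfl fun v hv => ?_
  rw [des_append_cons (fun a ha => hm a (ht (mem_of_mem_arrangements hu ha)))
    (fun a ha => hm a (Finset.mem_sdiff.1 (mem_of_mem_arrangements hv ha)).1), pow_add _ _ (des v)]

theorem gammaSum_insert {s : Finset α} {m : α} (hm : ∀ a ∈ s, m < a) :
    gammaSum (insert m s) = ∑ t ∈ s.powerset,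
      (if t = ∅ then 1 + X else X * gammaEndAsc t) * gammaSum (s \ t) := by
  have hms : m ∉ s := fun h => (hm m h).false
  rw [gammaSum, sum_arrangements_insert hms]
  refine Finset.sum_congr rfl fun t ht => ?_
  rw [Finset.mem_powerset] at ht
  have hcard := Finset.card_sdiff_add_card_eq_card ht
  rw [Finset.card_insert_of_notMem hms]
  have hu_gt {u} (hu : u ∈ arrangements t) : ∀ a ∈ u, m < a :=
    fun a ha => hm a (ht (mem_of_mem_arrangements hu ha))
  have hv_gt {v} (hv : v ∈ arrangements (s \ t)) : ∀ a ∈ v, m < a :=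
    fun a ha => hm a (Finset.mem_sdiff.1 (mem_of_mem_arrangements hv ha)).1
  split_ifs with h
  · subst h
    simp only [arrangements_empty, Finset.sum_singleton]
    rw [gammaSum, Finset.mul_sum]
    refine Finset.sum_congr rfl fun v hv => ?_
    rw [noDD_append_cons (by simp) (hv_gt hv), des_append_cons (by simp) (hv_gt hv)]
    by_cases hv' : NoDD v
    · have hle := hv'.two_mul_des_le
      rw [length_of_mem_arrangements hv] at hle
      simp only [des, NoDDEndAsc, hv', Finset.card_empty] at *
      rw [← hcard, show (s \ ∅).card + 0 + 1 - 2 * ((if True then 0 else 1) + 0 + des v) =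
        (s \ ∅).card - 2 * des v + 1 by simp; omega]
      simp
      ring
    · simp [hv']
  · rw [gammaSum, gammaEndAsc, mul_assoc, Finset.sum_mul_sum, Finset.mul_sum]
    refine Finset.sum_congr rfl fun u hu => ?_
    rw [Finset.mul_sum]
    refine Finset.sum_congr rfl fun v hv => ?_
    have hu0 : u ≠ [] := by rwa [Ne, eq_nil_iff_of_mem_arrangements hu]
    rw [noDD_append_cons (hu_gt hu) (hv_gt hv), des_append_cons (hu_gt hu) (hv_gt hv)]
    by_cases hv' : NoDD v
    · by_cases hu' : NoDDEndAsc u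
      · have hle := hv'.two_mul_des_le
        have hlt := hu'.two_mul_des_lt hu0
        rw [length_of_mem_arrangements hv] at hle
        rw [length_of_mem_arrangements hu] at hlt
        simp only [hu', hv', hu0, and_self, if_true, if_false]
        rw [show s.card + 1 - 2 * (1 + des u + des v) =
          (t.card - 1 - 2 * des u) + ((s \ t).card - 2 * des v) by omega]
        ring
      · simp [hu']
    · simp [hv']

theorem gammaEndAsc_insert {s : Finset α} {m : α} (hm : ∀ a ∈ s, m < a) (hs : s ≠ ∅) :
    gammaEndAsc (insert m s) = ∑ t ∈ s.powerset,
      if t = ∅ then (1 + X) * gammaEndAsc s else if s \ t = ∅ then 0 else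
        X * gammaEndAsc t * gammaEndAsc (s \ t) := by
  have hms : m ∉ s := fun h => (hm m h).false
  rw [gammaEndAsc, sum_arrangements_insert hms]
  refine Finset.sum_congr rfl fun t ht => ?_
  rw [Finset.mem_powerset] at ht
  have hcard := Finset.card_sdiff_add_card_eq_card ht
  rw [Finset.card_insert_of_notMem hms]
  have hu_gt {u} (hu : u ∈ arrangements t) : ∀ a ∈ u, m < a :=
    fun a ha => hm a (ht (mem_of_mem_arrangements hu ha))
  have hv_gt {v} (hv : v ∈ arrangements (s \ t)) : ∀ a ∈ v, m < a :=
    fun a ha => hm a (Finset.mem_sdiff.1 (mem_of_mem_arrangements hv ha)).1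
  split_ifs with h h'
  · subst h
    simp only [arrangements_empty, Finset.sum_singleton]
    rw [gammaEndAsc, Finset.mul_sum]
    simp only [Finset.sdiff_empty] at *
    refine Finset.sum_congr rfl fun v hv => ?_
    rw [noDDEndAsc_append_cons (by simp) (hv_gt hv), des_append_cons (by simp) (hv_gt hv)]
    by_cases hv' : NoDDEndAsc v
    · have hlt := hv'.two_mul_des_lt (by rwa [Ne, eq_nil_iff_of_mem_arrangements hv])
      rw [length_of_mem_arrangements hv] at hlt
      simp only [des, NoDDEndAsc, hv', implies_true, and_self, if_true, zero_add]
      rw [show s.card + 1 - 1 - 2 * des v = s.card - 1 - 2 * des v + 1 by omega]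
      ring
    · simp [hv']
  · refine Finset.sum_eq_zero fun u hu => Finset.sum_eq_zero fun v hv => ?_
    rw [noDDEndAsc_append_cons (hu_gt hu) (hv_gt hv), eq_nil_iff_of_mem_arrangements hu,
      eq_nil_iff_of_mem_arrangements hv]
    simp [h, h']
  · rw [gammaEndAsc, gammaEndAsc, mul_assoc, Finset.sum_mul_sum, Finset.mul_sum]
    refine Finset.sum_congr rfl fun u hu => ?_
    rw [Finset.mul_sum]
    refine Finset.sum_congr rfl fun v hv => ?_
    have hu0 : u ≠ [] := by rwa [Ne, eq_nil_iff_of_mem_arrangements hu]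
    have hv0 : v ≠ [] := by rwa [Ne, eq_nil_iff_of_mem_arrangements hv]
    rw [noDDEndAsc_append_cons (hu_gt hu) (hv_gt hv), des_append_cons (hu_gt hu) (hv_gt hv)]
    by_cases hv' : NoDDEndAsc v
    · by_cases hu' : NoDDEndAsc u
      · have hle := hv'.two_mul_des_lt hv0
        have hlt := hu'.two_mul_des_lt hu0
        rw [length_of_mem_arrangements hv] at hle
        rw [length_of_mem_arrangements hu] at hlt
        simp only [hu', hv', hu0, hv0, false_imp_iff, and_self, if_true, if_false]
        rw [show s.card + 1 - 1 - 2 * (1 + des u + des v) =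
          (t.card - 1 - 2 * des u) + ((s \ t).card - 1 - 2 * des v) by omega]
        ring
      · simp [hu']
    · simp [hv']

theorem gammaEndAsc_singleton (a : α) : gammaEndAsc {a} = 1 := by
  rw [← insert_empty_eq a, gammaEndAsc, sum_arrangements_insert (by simp)]
  simp [arrangements_empty, des, NoDDEndAsc]

/-- Gamma expansion of the Eulerian polynomials. -/
theorem gammaEndAsc_eq_eulerian (s : Finset α) (hs : s ≠ ∅) : gammaEndAsc s = eulerian s := by
  induction s using Finset.strongInduction with
  | H s ih =>
  have hne := Finset.nonempty_iff_ne_empty.2 hs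
  obtain ⟨m, r, hmr, rfl⟩ : ∃ m r, (∀ a ∈ r, m < a) ∧ s = insert m r :=
    ⟨s.min' hne, s.erase (s.min' hne), fun a ha => s.min'_lt_of_mem_erase_min' hne ha,
      (Finset.insert_erase (s.min'_mem hne)).symm⟩
  have hm : m ∉ r := fun h => (hmr m h).false
  rcases eq_or_ne r ∅ with rfl | hr
  · rw [eulerian_insert hmr]
    simp [gammaEndAsc_singleton, shiftedEulerian, eulerian_empty]
  have ih' : ∀ t ⊆ r, t ≠ ∅ → gammaEndAsc t = eulerian t := fun t ht h0 =>
    ih t (ht.trans_ssubset (Finset.ssubset_insert hm)) h0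
  have hsplit (t) (ht : t ∈ r.powerset) :
      shiftedEulerian t * eulerian (r \ t) =
      (if t = ∅ then (1 + X) * gammaEndAsc r else if r \ t = ∅ then 0 else
        X * gammaEndAsc t * gammaEndAsc (r \ t)) +
      ((if t = r then X * eulerian r else 0) - (if t = ∅ then X * eulerian r else 0)) := by
    rw [Finset.mem_powerset] at ht
    rw [shiftedEulerian]
    by_cases h0 : t = ∅
    · subst h0
      simp [hr.symm, ih' r subset_rfl hr]
      ring
    by_cases h1 : t = r
    · subst h1
      simp [h0, eulerian_empty]
    have h2 : r \ t ≠ ∅ := fun h =>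
      h1 (Finset.Subset.antisymm ht (Finset.sdiff_eq_empty_iff_subset.1 h))
    simp [h0, h1, h2, ih' t ht h0, ih' _ Finset.sdiff_subset h2]
  rw [gammaEndAsc_insert hmr hr, eulerian_insert hmr, Finset.sum_congr rfl hsplit,
    Finset.sum_add_distrib, Finset.sum_sub_distrib]
  simp

theorem sum_powerset_sum_powerset {M : Type*} [AddCommMonoid M] (s : Finset α)
    (g : Finset α → Finset α → M) :
    ∑ t ∈ s.powerset, ∑ u ∈ t.powerset, g u (t \ u) =
      ∑ u ∈ s.powerset, ∑ v ∈ (s \ u).powerset, g u v := by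
  rw [Finset.sum_sigma', Finset.sum_sigma']
  refine Finset.sum_bij' (fun p _ => ⟨p.2, p.1 \ p.2⟩) (fun p _ => ⟨p.1 ∪ p.2, p.1⟩) ?_ ?_ ?_ ?_ ?_
  · rintro ⟨t, u⟩ h
    simp only [Finset.mem_sigma, Finset.mem_powerset] at h ⊢
    exact ⟨h.2.trans h.1, Finset.sdiff_subset_sdiff h.1 subset_rfl⟩
  · rintro ⟨u, v⟩ h
    simp only [Finset.mem_sigma, Finset.mem_powerset] at h ⊢
    exact ⟨Finset.union_subset h.1 (h.2.trans Finset.sdiff_subset), Finset.subset_union_left⟩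
  · rintro ⟨t, u⟩ h
    simp only [Finset.mem_sigma, Finset.mem_powerset] at h ⊢
    rw [Finset.union_sdiff_of_subset h.2]
  · rintro ⟨u, v⟩ h
    simp only [Finset.mem_sigma, Finset.mem_powerset] at h ⊢
    rw [Finset.union_sdiff_cancel_left (Finset.disjoint_of_subset_right h.2 Finset.disjoint_sdiff)]
  · simp

theorem gammaSum_eq_sum_shiftedEulerian (s : Finset α) :
    gammaSum s = ∑ t ∈ s.powerset, shiftedEulerian t := by
  induction s using Finset.strongInduction with
  | H s ih =>
  rcases eq_or_ne s ∅ with rfl | hs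
  · simp [gammaSum_empty, shiftedEulerian]
  have hne := Finset.nonempty_iff_ne_empty.2 hs
  obtain ⟨m, r, hmr, rfl⟩ : ∃ m r, (∀ a ∈ r, m < a) ∧ s = insert m r :=
    ⟨s.min' hne, s.erase (s.min' hne), fun a ha => s.min'_lt_of_mem_erase_min' hne ha,
      (Finset.insert_erase (s.min'_mem hne)).symm⟩
  have hm : m ∉ r := fun h => (hmr m h).false
  have hX (v : Finset α) : X * eulerian v = shiftedEulerian v + if v = ∅ then X - 1 else 0 := by
    rw [shiftedEulerian]
    split_ifs with h
    · subst h
      simp [eulerian_empty]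
    · simp
  have hleft : ∑ t ∈ r.powerset, shiftedEulerian (insert m t) =
      ∑ u ∈ r.powerset, ∑ v ∈ (r \ u).powerset, shiftedEulerian u * (X * eulerian v) := by
    rw [← sum_powerset_sum_powerset r (fun u v => shiftedEulerian u * (X * eulerian v))]
    refine Finset.sum_congr rfl fun t ht => ?_
    rw [shiftedEulerian, if_neg (Finset.insert_ne_empty _ _),
      eulerian_insert (fun a ha => hmr a (Finset.mem_powerset.1 ht ha)), Finset.mul_sum]
    exact Finset.sum_congr rfl fun u _ => by ring
  have hright (t) (ht : t ∈ r.powerset) :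
      (if t = ∅ then 1 + X else X * gammaEndAsc t) * gammaSum (r \ t) =
        shiftedEulerian t * ∑ v ∈ (r \ t).powerset, shiftedEulerian v +
          if t = ∅ then X * ∑ v ∈ r.powerset, shiftedEulerian v else 0 := by
    rw [ih _ (Finset.sdiff_subset.trans_ssubset (Finset.ssubset_insert hm)), shiftedEulerian]
    split_ifs with h
    · subst h
      simp
      ring
    · rw [gammaEndAsc_eq_eulerian t h, add_zero]
  rw [gammaSum_insert hmr, Finset.sum_congr rfl hright, Finset.sum_powerset_insert hm, hleft]
  simp only [hX, mul_add, Finset.sum_add_distrib, ← Finset.mul_sum]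
  simp [← Finset.sum_mul]
  ring

theorem eulerian_eq_sum_perm {m : ℕ} {s : Finset α} (hs : s.card = m) :
    eulerian s = ∑ σ : Equiv.Perm (Fin m), X ^ des (List.ofFn σ) := by
  have himg : Finset.univ.image (s.orderEmbOfFin hs) = s := by
    rw [← Finset.coe_inj]
    simp
  rw [eulerian]
  conv_lhs => rw [← himg]
  rw [← sum_perm_eq_sum_arrangements (s.orderEmbOfFin hs).injective]
  refine Finset.sum_congr rfl fun σ _ => ?_
  rw [← des_map (s.orderEmbOfFin hs).strictMono, List.map_ofFn]
  rfl

theorem wB_succ {w : List ℕ} {i : ℕ} (h : i < w.length) : wB w (i + 1) = w.getD i 0 := by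
  rw [wB, if_pos ⟨by omega, by omega⟩, Nat.add_sub_cancel]

theorem desW_eq_sum (w : List ℕ) : desW w =
    ∑ i ∈ Finset.range (w.length - 1), if w.getD (i + 1) 0 < w.getD i 0 then 1 else 0 := by
  rw [desW, Finset.card_filter, ← Finset.Ico_add_one_right_eq_Icc, Finset.sum_Ico_eq_sum_range,
    Nat.add_sub_cancel]
  refine Finset.sum_congr rfl fun i hi => ?_
  rw [Finset.mem_range] at hi
  rw [add_comm 1 i, wB_succ (by omega), wB_succ (by omega)]

theorem desW_eq_des (w : List ℕ) : desW w = des w := by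
  rw [desW_eq_sum]
  induction w using des.induct with
  | case1 a b l ih =>
    simp only [des, ← ih, List.length_cons, Nat.add_sub_cancel]
    rw [Finset.sum_range_succ', add_comm]
    rfl
  | case2 l h =>
    match l, h with
    | [], _ => rfl
    | [_], _ => rfl
    | a :: b :: l, h => exact absurd rfl (h a b l)

theorem noDD_iff_getD : ∀ w : List ℕ, NoDD w ↔ ∀ i, i + 2 < w.length →
    ¬ (w.getD (i + 2) 0 < w.getD (i + 1) 0 ∧ w.getD (i + 1) 0 < w.getD i 0)
  | [] => by simp [NoDD]
  | [a] => by simp [NoDD]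
  | [a, b] => by simp [NoDD]
  | a :: b :: c :: l => by
    rw [NoDD, noDD_iff_getD (b :: c :: l)]
    constructor
    · rintro ⟨h0, h⟩ (_ | i) hi
      · exact h0
      · exact h i (by simpa using hi)
    · intro h
      exact ⟨h 0 (by simp), fun i hi => h (i + 1) (by simpa using hi)⟩

theorem noInternalDD_iff_noDD (w : List ℕ) : noInternalDD w ↔ NoDD w := by
  rw [noDD_iff_getD]
  constructor
  · intro h i hi
    have := h (i + 2) (Finset.mem_Icc.2 ⟨by omega, by omega⟩)
    rwa [wB_succ hi, wB_succ (by omega), show i + 2 - 1 = i + 1 by omega,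
      wB_succ (by omega)] at this
  · intro h i hi
    obtain ⟨i, rfl⟩ := Nat.exists_eq_add_of_le' (Finset.mem_Icc.1 hi).1
    have hi := (Finset.mem_Icc.1 hi).2
    rw [wB_succ (by omega), wB_succ (by omega), show i + 2 - 1 = i + 1 by omega,
      wB_succ (by omega)]
    exact h i (by omega)

theorem des_word {n : ℕ} (σ : Equiv.Perm (Fin n)) : des (word σ) = des (List.ofFn σ) := by
  rw [← des_map (e := fun i : Fin n => (i : ℕ) + 1) (fun _ _ h => by simpa using h), List.map_ofFn]
  rfl

end BinomialEulerian

open BinomialEulerian Polynomial in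
/-- Shareshian–Wachs: the `γ`-positivity expansion of the binomial-Eulerian
polynomial, where `c_{n,k}` counts permutations `σ ∈ S_n` with `k` descents and no index
`1 < i < n` with `σ_{i-1} > σ_i > σ_{i+1}`. -/
theorem binomialEulerian_gamma_positivity_SW (n : ℕ) (hn : 1 ≤ n) :
    ((1 : Polynomial ℤ) + Polynomial.X *
        ∑ m ∈ Finset.Icc 1 n, (n.choose m : Polynomial ℤ) *
          ∑ σ : Equiv.Perm (Fin m), Polynomial.X ^ desW (word σ))
      = ∑ k ∈ Finset.range (n / 2 + 1),
          (((Finset.univ : Finset (Equiv.Perm (Fin n))).filter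
              (fun σ => desW (word σ) = k ∧ noInternalDD (word σ))).card : Polynomial ℤ) *
            Polynomial.X ^ k * (1 + Polynomial.X) ^ (n - 2 * k) := by
  classical
  have hA (m : ℕ) : ∑ σ : Equiv.Perm (Fin m), (Polynomial.X : ℤ[X]) ^ desW (word σ) =
      ∑ σ : Equiv.Perm (Fin m), Polynomial.X ^ des (List.ofFn σ) :=
    Finset.sum_congr rfl fun σ _ => by rw [desW_eq_des, des_word]
  have hinj : Function.Injective (fun i : Fin n => (i : ℕ) + 1) := fun i j h => by
    simpa [Fin.ext_iff] using h
  set s : Finset ℕ := Finset.univ.image (fun i : Fin n => (i : ℕ) + 1) with hs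
  have hcard : s.card = n := by
    rw [hs, Finset.card_image_of_injective _ hinj, Finset.card_fin]
  have hright : ∑ k ∈ Finset.range (n / 2 + 1),
      (((Finset.univ : Finset (Equiv.Perm (Fin n))).filter
          (fun σ => desW (word σ) = k ∧ noInternalDD (word σ))).card : ℤ[X]) *
        Polynomial.X ^ k * (1 + Polynomial.X) ^ (n - 2 * k) = gammaSum s := by
    have hmaps : ∀ σ ∈ (Finset.univ : Finset (Equiv.Perm (Fin n))).filter
        (fun σ => noInternalDD (word σ)), desW (word σ) ∈ Finset.range (n / 2 + 1) := by
      intro σ hσ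
      have h := ((noInternalDD_iff_noDD _).1 (Finset.mem_filter.1 hσ).2).two_mul_des_le
      rw [word, List.length_ofFn, ← word] at h
      rw [desW_eq_des, Finset.mem_range]
      omega
    rw [gammaSum, ← sum_perm_eq_sum_arrangements hinj, hcard, ← Finset.sum_filter]
    have hword (σ : Equiv.Perm (Fin n)) : List.ofFn (fun i => (σ i : ℕ) + 1) = word σ := rfl
    simp_rw [hword, ← noInternalDD_iff_noDD, ← desW_eq_des]
    rw [← Finset.sum_fiberwise_of_maps_to hmaps]
    refine Finset.sum_congr rfl fun k _ => ?_
    rw [Finset.filter_filter, Finset.sum_congr rfl (g := fun _ =>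
      (Polynomial.X : ℤ[X]) ^ k * (1 + Polynomial.X) ^ (n - 2 * k)) (fun σ hσ => by
        rw [(Finset.mem_filter.1 hσ).2.2]), Finset.sum_const, nsmul_eq_mul, mul_assoc]
    simp_rw [and_comm]
  let g : ℕ → ℤ[X] := fun m =>
    if m = 0 then 1 else Polynomial.X * ∑ σ : Equiv.Perm (Fin m), Polynomial.X ^ desW (word σ)
  have hcongr (t) (_ : t ∈ s.powerset) : shiftedEulerian t = g t.card := by
    simp only [g, shiftedEulerian, eulerian_eq_sum_perm rfl, Finset.card_eq_zero, hA]
  rw [hright, gammaSum_eq_sum_shiftedEulerian, Finset.sum_congr rfl hcongr,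
    Finset.sum_powerset_apply_card g, hcard, Finset.sum_range_succ', Finset.mul_sum, add_comm,
    ← Finset.Ico_add_one_right_eq_Icc, Finset.sum_Ico_eq_sum_range, Nat.add_sub_cancel]
  congr 1
  · refine Finset.sum_congr rfl fun i _ => ?_
    rw [add_comm 1 i]
    simp only [g, Nat.add_eq_zero_iff, one_ne_zero, and_false, if_false, nsmul_eq_mul]
    ring
  · simp [g]
end
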